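/- arXiv:1901.06516 — 2 statements merged into one kernel-verified Lean document; each statement's English description precedes it below -/
import Mathlib

section
/- Let J>0, β>0, S>0, and let P_h be a probability distribution supported on [-S,S]. For each n≥1 let h_1,…,h_n be i.i.d. with law P_h and define the free energy f_n^rcw = -(1/(βn)) E ln Σ_{σ∈{-1,1}^n} exp(β[(J/n)Σ_{i<j}σ_iσ_j + Σ_i h_iσ_i]), the expectation being over the fields. Then lim_{n→∞} f_n^rcw = inf_{m∈[-1,1]} f̃^pot(m), where f̃^pot(m) = Jm²/2 - (1/β)∫dP_h(h) ln(2 cosh(β(Jm+h))). -/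
open Finset MeasureTheory

/-- spin value of a Boolean configuration entry: `true ↦ 1`, `false ↦ -1`. -/
noncomputable def spin (b : Bool) : ℝ := if b then 1 else -1

/-- `∑_{i<j} σ_i σ_j`. -/
noncomputable def pairSum (n : ℕ) (σ : Fin n → Bool) : ℝ :=
  ∑ i : Fin n, ∑ j ∈ Finset.univ.filter (fun j => i < j), spin (σ i) * spin (σ j)

/-- Quenched free energy of the Curie-Weiss model with i.i.d. random external
fields `h_i ∼ P_h`:
`f_n^rcw = -(1/(βn)) E ln Σ_σ exp(β[(J/n)Σ_{i<j}σ_iσ_j + Σ_i h_iσ_i])`. -/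
noncomputable def frcw (J β : ℝ) (Ph : Measure ℝ) (n : ℕ) : ℝ :=
  -(1 / (β * n)) * ∫ hs : Fin n → ℝ,
      Real.log (∑ σ : Fin n → Bool,
        Real.exp (β * (J / n * pairSum n σ + ∑ i : Fin n, hs i * spin (σ i))))
    ∂(Measure.pi fun _ : Fin n => Ph)

/-- The one-parameter potential
`f̃^pot(m) = Jm²/2 - (1/β) ∫ dP_h(h) ln(2 cosh(β(Jm + h)))`. -/
noncomputable def ftpotCW (J β : ℝ) (Ph : Measure ℝ) (m : ℝ) : ℝ :=
  J * m ^ 2 / 2 - (1 / β) * ∫ x, Real.log (2 * Real.cosh (β * (J * m + x))) ∂Ph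

/-- The random partition function of the Curie-Weiss model in the external fields `hs`. -/
noncomputable def partitionCW (J β : ℝ) (n : ℕ) (hs : Fin n → ℝ) : ℝ :=
  ∑ σ : Fin n → Bool, Real.exp (β * (J / n * pairSum n σ + ∑ i : Fin n, hs i * spin (σ i)))

/-- The single-site log-partition function at magnetization `m` and field `x`. -/
noncomputable def siteLog (J β m x : ℝ) : ℝ := Real.log (2 * Real.cosh (β * (J * m + x)))

/-- The log-partition function of the model linearized at magnetization `m`. -/
noncomputable def linearizedLog (J β m : ℝ) (n : ℕ) (hs : Fin n → ℝ) : ℝ :=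
  -(n * (β * J * m ^ 2 / 2)) + ∑ i, siteLog J β m (hs i)

theorem spin_mul_self (b : Bool) : spin b * spin b = 1 := by
  cases b <;> simp [spin]

theorem abs_spin (b : Bool) : |spin b| = 1 := by
  cases b <;> simp [spin]

theorem two_mul_pairSum (n : ℕ) (σ : Fin n → Bool) :
    2 * pairSum n σ = (∑ i, spin (σ i)) ^ 2 - n := by
  have hsymm : pairSum n σ =
      ∑ i : Fin n, ∑ j : Fin n, if j < i then spin (σ i) * spin (σ j) else 0 := by
    rw [Finset.sum_comm]
    simp only [pairSum, Finset.sum_filter]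
    refine Finset.sum_congr rfl fun i _ => Finset.sum_congr rfl fun j _ => ?_
    rw [mul_comm]
  have hdiag : (n : ℝ) =
      ∑ i : Fin n, ∑ j : Fin n, if i = j then spin (σ i) * spin (σ j) else 0 := by
    simp [spin_mul_self]
  have hdef : pairSum n σ =
      ∑ i : Fin n, ∑ j : Fin n, if i < j then spin (σ i) * spin (σ j) else 0 := by
    simp only [pairSum, Finset.sum_filter]
  have key : (∑ i, spin (σ i)) ^ 2 = pairSum n σ + pairSum n σ + n := by
    nth_rewrite 1 [hdef]
    nth_rewrite 1 [hsymm]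
    rw [hdiag]
    rw [sq, Finset.sum_mul_sum, ← Finset.sum_add_distrib, ← Finset.sum_add_distrib]
    refine Finset.sum_congr rfl fun i _ => ?_
    rw [← Finset.sum_add_distrib, ← Finset.sum_add_distrib]
    refine Finset.sum_congr rfl fun j _ => ?_
    rcases lt_trichotomy i j with h | h | h
    · simp [h, h.not_gt, h.ne]
    · simp [h]
    · simp [h, h.not_gt, h.ne']
  linarith

/-- Expansion of the energy around an arbitrary magnetization `m`. -/
theorem energy_eq_linearized (J m : ℝ) {n : ℕ} (hn : 0 < n) (hs : Fin n → ℝ)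
    (σ : Fin n → Bool) :
    J / n * pairSum n σ + ∑ i, hs i * spin (σ i) =
      -(n * (J * m ^ 2 / 2)) + ∑ i, (J * m + hs i) * spin (σ i)
        + (n * J / 2 * ((∑ i, spin (σ i)) / n - m) ^ 2 - J / 2) := by
  have hn' : (n : ℝ) ≠ 0 := by positivity
  have hp : pairSum n σ = ((∑ i, spin (σ i)) ^ 2 - n) / 2 := by
    linarith [two_mul_pairSum n σ]
  simp only [add_mul, Finset.sum_add_distrib, ← Finset.mul_sum]
  rw [hp]
  field_simp
  ring

theorem exp_siteLog (J β m x : ℝ) :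
    Real.exp (siteLog J β m x) = ∑ b : Bool, Real.exp (β * ((J * m + x) * spin b)) := by
  rw [siteLog, Real.exp_log (by have := Real.cosh_pos (β * (J * m + x)); positivity),
    Real.cosh_eq]
  rw [Fintype.sum_bool]
  simp only [spin, if_true, Bool.false_eq_true, if_false, mul_one, mul_neg]
  ring

theorem exp_linearizedLog (J β m : ℝ) (n : ℕ) (hs : Fin n → ℝ) :
    Real.exp (linearizedLog J β m n hs) = ∑ σ : Fin n → Bool,
      Real.exp (β * (-(n * (J * m ^ 2 / 2)) + ∑ i, (J * m + hs i) * spin (σ i))) := by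
  rw [linearizedLog, Real.exp_add, Real.exp_sum]
  simp only [exp_siteLog, Finset.prod_univ_sum, Fintype.piFinset_univ]
  rw [Finset.mul_sum]
  refine Finset.sum_congr rfl fun σ _ => ?_
  rw [← Real.exp_sum, ← Real.exp_add, ← Finset.mul_sum]
  congr 1
  ring

theorem partitionCW_pos (J β : ℝ) (n : ℕ) (hs : Fin n → ℝ) : 0 < partitionCW J β n hs :=
  Finset.sum_pos (fun _ _ => Real.exp_pos _) Finset.univ_nonempty

theorem linearizedLog_le_log_partitionCW {J β : ℝ} (hJ : 0 < J) (hβ : 0 < β) (m : ℝ) {n : ℕ}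
    (hn : 0 < n) (hs : Fin n → ℝ) :
    linearizedLog J β m n hs - β * J / 2 ≤ Real.log (partitionCW J β n hs) := by
  rw [Real.le_log_iff_exp_le (partitionCW_pos _ _ _ _), sub_eq_add_neg, Real.exp_add,
    exp_linearizedLog, Finset.sum_mul, partitionCW]
  refine Finset.sum_le_sum fun σ _ => ?_
  rw [← Real.exp_add, energy_eq_linearized J m hn, Real.exp_le_exp]
  have : 0 ≤ β * (n * J / 2 * ((∑ i, spin (σ i)) / n - m) ^ 2) := by positivity
  linarith

/-- The grid of mesh `1 / N` in `[-1, 1]`. -/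
noncomputable def gridPoint (N : ℕ) (k : ℤ) : ℝ := k / N

theorem gridPoint_mem {N : ℕ} (hN : 0 < N) {k : ℤ} (hk : k ∈ Finset.Icc (-(N : ℤ)) N) :
    gridPoint N k ∈ Set.Icc (-1 : ℝ) 1 := by
  have hN' : (0 : ℝ) < N := by exact_mod_cast hN
  rw [Finset.mem_Icc] at hk
  have h1 : (-(N : ℝ)) ≤ k := by exact_mod_cast hk.1
  have h2 : (k : ℝ) ≤ N := by exact_mod_cast hk.2
  rw [gridPoint, Set.mem_Icc, le_div_iff₀ hN', div_le_iff₀ hN']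
  constructor <;> linarith

theorem exists_gridPoint_near {N : ℕ} (hN : 0 < N) {t : ℝ} (ht : |t| ≤ 1) :
    ∃ k ∈ Finset.Icc (-(N : ℤ)) N, (t - gridPoint N k) ^ 2 ≤ (1 / N : ℝ) ^ 2 := by
  have hN' : (0 : ℝ) < N := by exact_mod_cast hN
  obtain ⟨h1, h2⟩ := abs_le.1 ht
  refine ⟨⌊t * N⌋, ?_, ?_⟩
  · rw [Finset.mem_Icc]
    constructor
    · rw [Int.le_floor]
      push_cast
      nlinarith
    · have : (⌊t * N⌋ : ℝ) ≤ N := (Int.floor_le _).trans (by nlinarith)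
      exact_mod_cast this
  · have e : t - gridPoint N ⌊t * N⌋ = (t * N - ⌊t * N⌋) / N := by
      rw [gridPoint]
      field_simp
    rw [e]
    have h3 := Int.floor_le (t * N)
    have h4 := Int.lt_floor_add_one (t * N)
    have h5 : 0 ≤ t * N - ⌊t * N⌋ := by linarith
    gcongr
    linarith

theorem partitionCW_le_sum_grid {J β : ℝ} (hJ : 0 < J) (hβ : 0 < β) {n N : ℕ} (hn : 0 < n)
    (hN : 0 < N) (hs : Fin n → ℝ) :
    partitionCW J β n hs ≤ ∑ k ∈ Finset.Icc (-(N : ℤ)) N,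
      Real.exp (linearizedLog J β (gridPoint N k) n hs + n * (β * J / 2 * (1 / N) ^ 2)) := by
  simp only [Real.exp_add, exp_linearizedLog, Finset.sum_mul]
  rw [Finset.sum_comm, partitionCW]
  refine Finset.sum_le_sum fun σ _ => ?_
  have hn' : (0 : ℝ) < n := by exact_mod_cast hn
  have hM : |(∑ i, spin (σ i)) / n| ≤ 1 := by
    rw [abs_div, Nat.abs_cast, div_le_one hn']
    refine (Finset.abs_sum_le_sum_abs _ _).trans ?_
    simp [abs_spin]
  obtain ⟨k, hk, hkt⟩ := exists_gridPoint_near hN hM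
  refine le_trans ?_ (Finset.single_le_sum (fun _ _ => by positivity) hk)
  rw [← Real.exp_add, energy_eq_linearized J (gridPoint N k) hn, Real.exp_le_exp]
  have h : β * (n * J / 2 * ((∑ i, spin (σ i)) / n - gridPoint N k) ^ 2) ≤
      β * (n * J / 2 * (1 / N) ^ 2) := by gcongr
  have : 0 < β * J / 2 := by positivity
  linarith

theorem continuous_siteLog (J β m : ℝ) : Continuous (siteLog J β m) := by
  unfold siteLog
  refine Continuous.log (by fun_prop) fun x => ?_
  have := Real.cosh_pos (β * (J * m + x))
  positivity

theorem continuous_linearizedLog (J β m : ℝ) (n : ℕ) : Continuous (linearizedLog J β m n) := by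
  unfold linearizedLog
  exact continuous_const.add (continuous_finsetSum _ fun i _ =>
    (continuous_siteLog J β m).comp (continuous_apply i))

theorem continuous_log_partitionCW (J β : ℝ) (n : ℕ) :
    Continuous fun hs => Real.log (partitionCW J β n hs) := by
  refine Continuous.log ?_ fun hs => (partitionCW_pos J β n hs).ne'
  unfold partitionCW
  fun_prop

theorem Continuous.integrable_of_ae_mem_isCompact {X : Type*} [TopologicalSpace X]
    [MeasurableSpace X] [OpensMeasurableSpace X] [T2Space X] {μ : Measure X}
    [IsFiniteMeasure μ] {f : X → ℝ} (hf : Continuous f) {K : Set X} (hK : IsCompact K)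
    (h : ∀ᵐ x ∂μ, x ∈ K) : Integrable f μ := by
  have := hf.continuousOn.integrableOn_of_subset_isCompact (μ := μ) hK hK.measurableSet
    subset_rfl (measure_ne_top _ _)
  rwa [IntegrableOn, Measure.restrict_eq_self_of_ae_mem h] at this

theorem ae_pi_mem_Icc {S : ℝ} {Ph : Measure ℝ} [IsProbabilityMeasure Ph]
    (hsupp : ∀ᵐ x ∂Ph, x ∈ Set.Icc (-S) S) (n : ℕ) :
    ∀ᵐ hs ∂(Measure.pi fun _ : Fin n => Ph),
      hs ∈ Set.Icc (fun _ : Fin n => -S) (fun _ => S) := by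
  have h : ∀ i : Fin n, ∀ᵐ hs ∂(Measure.pi fun _ : Fin n => Ph), hs i ∈ Set.Icc (-S) S :=
    fun i => (Measure.tendsto_eval_ae_ae (μ := fun _ : Fin n => Ph) (i := i)).eventually hsupp
  filter_upwards [ae_all_iff.2 h] with hs hh
  exact ⟨fun i => (hh i).1, fun i => (hh i).2⟩

section Averages

variable {J β S : ℝ} {Ph : Measure ℝ} [IsProbabilityMeasure Ph]

theorem Continuous.integrable_pi_of_ae_mem_Icc (hsupp : ∀ᵐ x ∂Ph, x ∈ Set.Icc (-S) S) {n : ℕ}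
    {f : (Fin n → ℝ) → ℝ} (hf : Continuous f) :
    Integrable f (Measure.pi fun _ : Fin n => Ph) :=
  hf.integrable_of_ae_mem_isCompact isCompact_Icc (ae_pi_mem_Icc hsupp n)

theorem integrable_siteLog (hsupp : ∀ᵐ x ∂Ph, x ∈ Set.Icc (-S) S) (m : ℝ) :
    Integrable (siteLog J β m) Ph :=
  (continuous_siteLog J β m).integrable_of_ae_mem_isCompact isCompact_Icc hsupp

theorem memLp_siteLog (hsupp : ∀ᵐ x ∂Ph, x ∈ Set.Icc (-S) S) (m : ℝ) :
    MemLp (siteLog J β m) 2 Ph :=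
  (memLp_two_iff_integrable_sq (continuous_siteLog J β m).aestronglyMeasurable).2
    (((continuous_siteLog J β m).pow 2).integrable_of_ae_mem_isCompact isCompact_Icc hsupp)

theorem integral_sum_siteLog (hsupp : ∀ᵐ x ∂Ph, x ∈ Set.Icc (-S) S) (m : ℝ) (n : ℕ) :
    ∫ hs : Fin n → ℝ, ∑ i, siteLog J β m (hs i) ∂(Measure.pi fun _ : Fin n => Ph) =
      n * ∫ x, siteLog J β m x ∂Ph := by
  rw [integral_finsetSum _ fun i _ =>
    integrable_comp_eval (μ := fun _ : Fin n => Ph) (i := i) (integrable_siteLog hsupp m)]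
  have h : ∀ i : Fin n, ∫ hs : Fin n → ℝ, siteLog J β m (hs i)
      ∂(Measure.pi fun _ : Fin n => Ph) = ∫ x, siteLog J β m x ∂Ph := fun i =>
    integral_comp_eval (μ := fun _ : Fin n => Ph) (i := i)
      (continuous_siteLog J β m).aestronglyMeasurable
  simp [h]

theorem integral_linearizedLog (hβ : 0 < β) (hsupp : ∀ᵐ x ∂Ph, x ∈ Set.Icc (-S) S) (m : ℝ)
    (n : ℕ) :
    ∫ hs, linearizedLog J β m n hs ∂(Measure.pi fun _ : Fin n => Ph) =
      -(β * n * ftpotCW J β Ph m) := by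
  unfold linearizedLog
  rw [integral_add (integrable_const _) (integrable_finsetSum _ fun i _ =>
    integrable_comp_eval (μ := fun _ : Fin n => Ph) (i := i) (integrable_siteLog hsupp m)),
    integral_sum_siteLog hsupp]
  simp only [ftpotCW, siteLog, integral_const, probReal_univ, one_smul]
  field_simp
  ring

theorem integral_sq_linearizedLog_sub (hβ : 0 < β) (hsupp : ∀ᵐ x ∂Ph, x ∈ Set.Icc (-S) S)
    (m : ℝ) (n : ℕ) :
    ∫ hs, (linearizedLog J β m n hs + β * n * ftpotCW J β Ph m) ^ 2
      ∂(Measure.pi fun _ : Fin n => Ph) =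
      n * ProbabilityTheory.variance (siteLog J β m) Ph := by
  have h := ProbabilityTheory.variance_sum_pi (μ := fun _ : Fin n => Ph)
    (X := fun _ => siteLog J β m) fun _ => memLp_siteLog hsupp m
  have hc : Continuous (∑ i : Fin n, fun hs : Fin n → ℝ => siteLog J β m (hs i)) := by
    rw [Finset.sum_fn]
    exact continuous_finsetSum _ fun i _ =>
      (continuous_siteLog J β m).comp (continuous_apply i)
  rw [ProbabilityTheory.variance_eq_integral hc.measurable.aemeasurable] at h
  simp only [Finset.sum_apply, integral_sum_siteLog hsupp, Finset.sum_const, Finset.card_univ,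
    Fintype.card_fin, nsmul_eq_mul] at h
  rw [← h]
  congr 1
  ext hs
  simp only [linearizedLog, ftpotCW, siteLog]
  field_simp
  ring

theorem frcw_eq (J β : ℝ) (Ph : Measure ℝ) (n : ℕ) :
    frcw J β Ph n = -(1 / (β * n)) *
      ∫ hs, Real.log (partitionCW J β n hs) ∂(Measure.pi fun _ : Fin n => Ph) := rfl

theorem frcw_le (hJ : 0 < J) (hβ : 0 < β) (hsupp : ∀ᵐ x ∂Ph, x ∈ Set.Icc (-S) S) (m : ℝ)
    {n : ℕ} (hn : 0 < n) :
    frcw J β Ph n ≤ ftpotCW J β Ph m + J / 2 / n := by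
  have hn' : (0 : ℝ) < n := by exact_mod_cast hn
  have hint := (continuous_linearizedLog J β m n).integrable_pi_of_ae_mem_Icc hsupp
  have h := integral_mono (hint.sub (integrable_const (β * J / 2)))
    ((continuous_log_partitionCW J β n).integrable_pi_of_ae_mem_Icc hsupp)
    (linearizedLog_le_log_partitionCW hJ hβ m hn)
  simp only [Pi.sub_apply] at h
  rw [integral_sub hint (integrable_const _), integral_linearizedLog hβ hsupp] at h
  simp only [integral_const, probReal_univ, one_smul] at h
  rw [frcw_eq]
  have h2 : ftpotCW J β Ph m + J / 2 / n =
      -(1 / (β * n)) * (-(β * n * ftpotCW J β Ph m) - β * J / 2) := by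
    field_simp
    ring
  rw [h2]
  exact mul_le_mul_of_nonpos_left h (neg_nonpos.2 (by positivity))

theorem le_frcw (hJ : 0 < J) (hβ : 0 < β) (hsupp : ∀ᵐ x ∂Ph, x ∈ Set.Icc (-S) S) {I : ℝ}
    (hI : ∀ m ∈ Set.Icc (-1 : ℝ) 1, I ≤ ftpotCW J β Ph m) {N : ℕ} (hN : 0 < N) :
    ∃ D : ℝ, ∀ n : ℕ, 0 < n → I - (J / 2 + 1 / β) / N - D / n ≤ frcw J β Ph n := by
  set G := Finset.Icc (-(N : ℤ)) N with hG
  have hN' : (1 : ℝ) ≤ N := by exact_mod_cast hN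
  have hGne : G.Nonempty := ⟨0, by simp [hG]⟩
  have hcard : (0 : ℝ) < G.card := by exact_mod_cast hGne.card_pos
  set δ : ℝ := 1 / (N * G.card) with hδ
  have hδpos : 0 < δ := by positivity
  set V : ℝ := ∑ k ∈ G, ProbabilityTheory.variance (siteLog J β (gridPoint N k)) Ph with hV
  refine ⟨(Real.log G.card + V / (4 * δ)) / β, fun n hn => ?_⟩
  have hn' : (0 : ℝ) < n := by exact_mod_cast hn
  let Y : ℤ → (Fin n → ℝ) → ℝ := fun k hs =>
    (linearizedLog J β (gridPoint N k) n hs + β * n * ftpotCW J β Ph (gridPoint N k)) ^ 2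
  have hYint : ∀ k, Integrable (Y k) (Measure.pi fun _ : Fin n => Ph) := fun k =>
    (((continuous_linearizedLog J β (gridPoint N k) n).add
      continuous_const).pow 2).integrable_pi_of_ae_mem_Icc hsupp
  let c : ℝ := Real.log G.card - β * n * I + n * (β * J / 2 * (1 / N) ^ 2) + n / N
  have hbound : ∀ hs : Fin n → ℝ, Real.log (partitionCW J β n hs) ≤
      c + ∑ k ∈ G, Y k hs / (4 * δ * n) := by
    intro hs
    rw [Real.log_le_iff_le_exp (partitionCW_pos _ _ _ _)]
    refine (partitionCW_le_sum_grid hJ hβ hn hN hs).trans ?_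
    have hterm : ∀ k ∈ G, Real.exp (linearizedLog J β (gridPoint N k) n hs
        + n * (β * J / 2 * (1 / N) ^ 2)) ≤
        Real.exp (c - Real.log G.card + ∑ k ∈ G, Y k hs / (4 * δ * n)) := by
      intro k hk
      rw [Real.exp_le_exp]
      have hIk : β * n * I ≤ β * n * ftpotCW J β Ph (gridPoint N k) :=
        mul_le_mul_of_nonneg_left (hI _ (gridPoint_mem hN hk)) (by positivity)
      have hsingle : Y k hs / (4 * δ * n) ≤ ∑ k ∈ G, Y k hs / (4 * δ * n) :=
        Finset.single_le_sum (f := fun k => Y k hs / (4 * δ * n))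
          (fun i _ => div_nonneg (sq_nonneg _) (by positivity)) hk
      have hYoung : linearizedLog J β (gridPoint N k) n hs
          + β * n * ftpotCW J β Ph (gridPoint N k) ≤ δ * n + Y k hs / (4 * δ * n) := by
        have hp : 0 < 4 * δ * n := by positivity
        rw [← sub_le_iff_le_add', le_div_iff₀ hp]
        simp only [Y]
        nlinarith [sq_nonneg (linearizedLog J β (gridPoint N k) n hs
          + β * n * ftpotCW J β Ph (gridPoint N k) - 2 * δ * n)]
      have hδn : δ * n ≤ n / N := by
        rw [hδ, div_mul_eq_mul_div, one_mul]
        have : (1 : ℝ) ≤ G.card := by exact_mod_cast hGne.card_pos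
        gcongr
        nlinarith
      simp only [c]
      linarith
    refine (Finset.sum_le_sum hterm).trans ?_
    rw [Finset.sum_const, nsmul_eq_mul]
    nth_rewrite 1 [← Real.exp_log hcard]
    rw [← Real.exp_add]
    exact (congrArg Real.exp (by ring)).le
  have hsumint : Integrable (fun hs => ∑ k ∈ G, Y k hs / (4 * δ * n))
      (Measure.pi fun _ : Fin n => Ph) :=
    integrable_finsetSum _ fun k _ => (hYint k).div_const _
  have h := integral_mono
    ((continuous_log_partitionCW J β n).integrable_pi_of_ae_mem_Icc hsupp)
    ((integrable_const c).add hsumint) hbound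
  simp only [Pi.add_apply] at h
  rw [integral_add (integrable_const _) hsumint,
    integral_finsetSum _ fun k _ => (hYint k).div_const _] at h
  simp only [integral_div, Y, integral_sq_linearizedLog_sub hβ hsupp, integral_const,
    probReal_univ, one_smul] at h
  rw [← Finset.sum_div, ← Finset.mul_sum, ← hV] at h
  have h2 := mul_le_mul_of_nonpos_left h
    (neg_nonpos.2 (by positivity : 0 ≤ 1 / (β * (n : ℝ))))
  rw [frcw_eq]
  refine le_trans ?_ h2
  have h3 : -(1 / (β * n)) * (c + n * V / (4 * δ * n)) =
      I - (J / 2 * (1 / N) ^ 2 + 1 / β / N) - (Real.log G.card + V / (4 * δ)) / β / n := by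
    simp only [c]
    field_simp
    ring
  rw [h3]
  have h4 : J / 2 * (1 / N : ℝ) ^ 2 ≤ J / 2 * (1 / N) := by
    have h5 : (1 / N : ℝ) ≤ 1 := by
      rw [div_le_one (by positivity)]
      exact hN'
    have h6 : (0 : ℝ) ≤ 1 / N := by positivity
    have : (1 / N : ℝ) ^ 2 ≤ 1 / N := by nlinarith
    gcongr
  have h7 : (J / 2 + 1 / β) / N = J / 2 * (1 / N) + 1 / β / N := by ring
  linarith

end Averages

/-- Replica-symmetric formula for the Curie-Weiss model with random external fields:
`lim_{n→∞} f_n^rcw = inf_{m∈[-1,1]} f̃^pot(m)`. -/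
theorem curieWeiss_randomField_replica_formula (J β S : ℝ) (hJ : 0 < J) (hβ : 0 < β)
    (hS : 0 < S) (Ph : Measure ℝ) [IsProbabilityMeasure Ph]
    (hsupp : ∀ᵐ x ∂Ph, x ∈ Set.Icc (-S) S) :
    Filter.Tendsto (fun n : ℕ => frcw J β Ph n) Filter.atTop
      (nhds (sInf ((fun m => ftpotCW J β Ph m) '' Set.Icc (-1 : ℝ) 1))) := by
  set I := sInf ((fun m => ftpotCW J β Ph m) '' Set.Icc (-1 : ℝ) 1) with hIdef
  have hbdd : BddBelow ((fun m => ftpotCW J β Ph m) '' Set.Icc (-1 : ℝ) 1) := by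
    refine ⟨frcw J β Ph 1 - J / 2, ?_⟩
    rintro _ ⟨m, -, rfl⟩
    have := frcw_le hJ hβ hsupp m one_pos
    simp only [Nat.cast_one, div_one] at this
    linarith
  have hne : ((fun m => ftpotCW J β Ph m) '' Set.Icc (-1 : ℝ) 1).Nonempty :=
    (Set.nonempty_Icc.2 (by norm_num)).image _
  have hI : ∀ m ∈ Set.Icc (-1 : ℝ) 1, I ≤ ftpotCW J β Ph m := fun m hm =>
    csInf_le hbdd (Set.mem_image_of_mem _ hm)
  have hupper : ∀ n : ℕ, 0 < n → frcw J β Ph n ≤ I + J / 2 / n := by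
    intro n hn
    rw [← sub_le_iff_le_add]
    refine le_csInf hne ?_
    rintro _ ⟨m, -, rfl⟩
    exact sub_le_iff_le_add.2 (frcw_le hJ hβ hsupp m hn)
  rw [Metric.tendsto_atTop']
  intro ε hε
  have hsmall : ∀ a : ℝ, ∀ᶠ n : ℕ in Filter.atTop, a / n < ε / 2 := fun a =>
    (tendsto_const_div_atTop_nhds_zero_nat a).eventually_lt_const (half_pos hε)
  obtain ⟨N, hN, hNpos⟩ := ((hsmall (J / 2 + 1 / β)).and (Filter.eventually_gt_atTop 0)).exists
  obtain ⟨D, hD⟩ := le_frcw hJ hβ hsupp hI hNpos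
  obtain ⟨n₀, hn₀⟩ := Filter.eventually_atTop.1 ((hsmall D).and (hsmall (J / 2)))
  refine ⟨n₀, fun n hn => ?_⟩
  obtain ⟨h1, h2⟩ := hn₀ n hn.le
  have hnpos : 0 < n := (Nat.zero_le _).trans_lt hn
  have h3 := hD n hnpos
  have h4 := hupper n hnpos
  rw [Real.dist_eq, abs_lt]
  constructor <;> linarith
end

section
/- In the setting of the random-field Curie-Weiss interpolating model (coupling J>0, inverse temperature β>0, i.i.d. fields h_i∼P_h supported on [-S,S], time t∈[0,1], effective field R_ε(t) for ε∈[s_n,2s_n] with s_n∈(0,1/2], assuming ε↦R_ε(t) is regular), there exists a constant C(S,J)>0 depending only on S and J such that ∫_{s_n}^{2s_n} dε E[(⟨M⟩_{t,ε} - E⟨M⟩_{t,ε})²] ≤ C(S,J)·(s_n/n)^{1/3}. -/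
open Finset MeasureTheory

/-- `∑_i σ_i`. -/
noncomputable def magSum (n : ℕ) (σ : Fin n → Bool) : ℝ :=
  ∑ i : Fin n, spin (σ i)

/-- Interpolating Hamiltonian for the Curie-Weiss model with random external fields:
`H_{t,R}(σ;h) = (1-t)(-(J/n)Σ_{i<j}σ_iσ_j) - J R Σ_i σ_i - Σ_i h_iσ_i`. -/
noncomputable def Hrcw (J : ℝ) (n : ℕ) (t R : ℝ) (hs : Fin n → ℝ) (σ : Fin n → Bool) : ℝ :=
  (1 - t) * (-(J / n) * pairSum n σ) - J * R * magSum n σ - ∑ i : Fin n, hs i * spin (σ i)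

/-- Gibbs expectation `⟨A⟩_{t,R}` for the random-field interpolating model (at fixed
realization `hs` of the external fields). -/
noncomputable def gibbsRCW (J β : ℝ) (n : ℕ) (t R : ℝ) (hs : Fin n → ℝ)
    (A : (Fin n → Bool) → ℝ) : ℝ :=
  (∑ σ : Fin n → Bool, A σ * Real.exp (-(β * Hrcw J n t R hs σ))) /
  (∑ σ : Fin n → Bool, Real.exp (-(β * Hrcw J n t R hs σ)))

/-- Magnetization `M(σ) = (1/n) Σ_i σ_i`. -/
noncomputable def mag (n : ℕ) (σ : Fin n → Bool) : ℝ := magSum n σ / n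

/-- Variance bound for functions with bounded differences of i.i.d. variables. -/
theorem integral_sub_integral_sq_le_of_bounded_differences (μ : Measure ℝ) [IsProbabilityMeasure μ]
    (c B : ℝ) (n : ℕ) (f : (Fin n → ℝ) → ℝ) (hf : Measurable f) (hB : ∀ x, |f x| ≤ B)
    (hd : ∀ x y i, (∀ j, j ≠ i → x j = y j) → |f x - f y| ≤ c) :
    ∫ x, (f x - ∫ y, f y ∂(Measure.pi fun _ : Fin n => μ)) ^ 2 ∂(Measure.pi fun _ : Fin n => μ)
      ≤ n * c ^ 2 := by
  induction n with
  | zero =>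
    have h : ∀ x, f x = f 0 := fun x => congrArg f (Subsingleton.elim _ _)
    simp [h]
  | succ n ih =>
    set P := Measure.pi fun _ : Fin n => μ
    have hmp := (measurePreserving_piFinSuccAbove (fun _ : Fin (n + 1) => μ) 0).symm
    set e := (MeasurableEquiv.piFinSuccAbove (fun _ : Fin (n + 1) => ℝ) 0).symm
    have hes : ∀ z (j : Fin n), e z j.succ = z.2 j := fun z j => rfl
    have hint : ∀ G : (Fin (n + 1) → ℝ) → ℝ,
        ∫ x, G x ∂(Measure.pi fun _ : Fin (n + 1) => μ) = ∫ z, G (e z) ∂(μ.prod P) :=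
      fun G => (hmp.integral_comp e.measurableEmbedding G).symm
    have hFm : Measurable fun z => f (e z) := hf.comp e.measurable
    have hFx : ∀ x, Measurable fun y => f (e (x, y)) := fun x =>
      hFm.comp measurable_prodMk_left
    have hFi : ∀ x, Integrable (fun y => f (e (x, y))) P := fun x =>
      Integrable.of_bound (hFx x).aestronglyMeasurable B (Filter.Eventually.of_forall fun _ => hB _)
    have hFint : Integrable (fun z => f (e z)) (μ.prod P) :=
      Integrable.of_bound hFm.aestronglyMeasurable B (Filter.Eventually.of_forall fun _ => hB _)
    rw [hint, hint]
    set a := ∫ z, f (e z) ∂(μ.prod P)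
    set g : ℝ → ℝ := fun x => ∫ y, f (e (x, y)) ∂P with hg
    have hag : a = ∫ x, g x ∂μ := integral_prod _ hFint
    have hgi : Integrable g μ := hFint.integral_prod_left
    have hgd : ∀ x x', |g x - g x'| ≤ c := by
      intro x x'
      rw [hg]
      simp only
      rw [← integral_sub (hFi x) (hFi x')]
      have := norm_integral_le_of_norm_le_const (μ := P) (C := c)
        (f := fun y => f (e (x, y)) - f (e (x', y)))
        (Filter.Eventually.of_forall fun y => hd _ _ 0 (by
          intro j hj
          obtain ⟨k, rfl⟩ := Fin.exists_succ_eq.2 hj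
          rw [hes, hes]))
      simpa using this
    have hga : ∀ x, |g x - a| ≤ c := by
      intro x
      have h1 : g x - a = ∫ x', (g x - g x') ∂μ := by
        rw [integral_sub (integrable_const _) hgi, hag]; simp
      rw [h1]
      have := norm_integral_le_of_norm_le_const (μ := μ) (C := c)
        (f := fun x' => g x - g x') (Filter.Eventually.of_forall fun y => hgd x y)
      simpa using this
    have ha_le : |a| ≤ B := by
      have := norm_integral_le_of_norm_le_const (μ := μ.prod P) (C := B)
        (f := fun z => f (e z)) (Filter.Eventually.of_forall fun y => hB _)
      simpa using this
    have hsq : Integrable (fun z => (f (e z) - a) ^ 2) (μ.prod P) := by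
      refine Integrable.of_bound ((hFm.sub_const a).pow_const 2).aestronglyMeasurable
        ((B + B) ^ 2) (Filter.Eventually.of_forall fun z => ?_)
      rw [norm_pow]
      exact pow_le_pow_left₀ (norm_nonneg _)
        ((abs_sub _ _).trans (add_le_add (hB _) ha_le)) 2
    rw [integral_prod _ hsq]
    have hinner : ∀ x, ∫ y, (f (e (x, y)) - a) ^ 2 ∂P ≤ n * c ^ 2 + c ^ 2 := by
      intro x
      have hI := ih (fun y => f (e (x, y))) (hFx x) (fun _ => hB _) (by
        intro y y' i hy
        refine hd _ _ i.succ fun j hj => ?_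
        rcases Fin.eq_zero_or_eq_succ j with rfl | ⟨k, rfl⟩
        · rfl
        · rw [hes, hes]
          exact hy k fun h => hj (by rw [h]))
      have hsqx : Integrable (fun y => (f (e (x, y)) - g x) ^ 2) P := by
        refine Integrable.of_bound (((hFx x).sub_const _).pow_const 2).aestronglyMeasurable
          ((B + |g x|) ^ 2) (Filter.Eventually.of_forall fun z => ?_)
        rw [norm_pow]
        exact pow_le_pow_left₀ (norm_nonneg _)
          ((abs_sub _ _).trans (add_le_add (hB _) le_rfl)) 2
      have hlin : Integrable (fun y => 2 * (g x - a) * (f (e (x, y)) - g x)) P :=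
        ((hFi x).sub (integrable_const _)).const_mul _
      have h1 : ∫ y, (f (e (x, y)) - a) ^ 2 ∂P
          = ∫ y, (f (e (x, y)) - g x) ^ 2 ∂P + (g x - a) ^ 2 := by
        have h2 : ∀ y, (f (e (x, y)) - a) ^ 2 = (f (e (x, y)) - g x) ^ 2
            + 2 * (g x - a) * (f (e (x, y)) - g x) + (g x - a) ^ 2 := fun y => by ring
        simp_rw [h2]
        have hadd : Integrable (fun y => (f (e (x, y)) - g x) ^ 2
            + 2 * (g x - a) * (f (e (x, y)) - g x)) P := hsqx.add hlin
        rw [integral_add hadd (integrable_const _), integral_add hsqx hlin,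
          integral_const_mul, integral_sub (hFi x) (integrable_const _)]
        simp [hg]
      rw [h1]
      exact add_le_add hI (sq_le_sq' (abs_le.1 (hga x)).1 (abs_le.1 (hga x)).2)
    calc ∫ x, ∫ y, (f (e (x, y)) - a) ^ 2 ∂P ∂μ ≤ ∫ _x, (n * c ^ 2 + c ^ 2) ∂μ :=
          integral_mono hsq.integral_prod_left (integrable_const _) hinner
      _ = ((n + 1 : ℕ) : ℝ) * c ^ 2 := by
          simp; ring

/-- A differentiable function with monotone derivative lies between its tangents. -/
theorem sub_mem_Icc_of_hasDerivAt_of_monotone {F m : ℝ → ℝ} (hF : ∀ r, HasDerivAt F (m r) r)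
    (hm : Monotone m) {x y : ℝ} (hxy : x < y) :
    m x * (y - x) ≤ F y - F x ∧ F y - F x ≤ m y * (y - x) := by
  obtain ⟨z, hz, h⟩ := exists_hasDerivAt_eq_slope F m hxy
    (fun z _ => (hF z).continuousAt.continuousWithinAt) (fun z _ => hF z)
  have hpos : 0 < y - x := sub_pos.2 hxy
  rw [eq_div_iff hpos.ne'] at h
  rw [← h]
  exact ⟨mul_le_mul_of_nonneg_right (hm hz.1.le) hpos.le,
    mul_le_mul_of_nonneg_right (hm hz.2.le) hpos.le⟩

theorem sq_le_of_abs_le_add {A D E Δ u δ : ℝ} (hδ : 0 < δ) (hΔ0 : 0 ≤ Δ) (hΔ2 : Δ ≤ 2)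
    (hu : |δ * u| ≤ |A| + |D| + |E| + δ * Δ) :
    u ^ 2 ≤ 4 / δ ^ 2 * A ^ 2 + 4 / δ ^ 2 * D ^ 2 + 4 / δ ^ 2 * E ^ 2 + 8 * Δ := by
  have hs := sq_le_sq' (abs_le.1 hu).1 (abs_le.1 hu).2
  have hs2 : (|A| + |D| + |E| + δ * Δ) ^ 2 ≤ 4 * (A ^ 2 + D ^ 2 + E ^ 2 + (δ * Δ) ^ 2) := by
    rw [← sq_abs A, ← sq_abs D, ← sq_abs E]
    linarith [sq_nonneg (|A| - |D|), sq_nonneg (|A| - |E|), sq_nonneg (|A| - δ * Δ),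
      sq_nonneg (|D| - |E|), sq_nonneg (|D| - δ * Δ), sq_nonneg (|E| - δ * Δ)]
  have hΔs : Δ ^ 2 ≤ 2 * Δ := by
    rw [sq]
    exact mul_le_mul_of_nonneg_right hΔ2 hΔ0
  have hδ2 : 0 < δ ^ 2 := by positivity
  refine le_of_mul_le_mul_left ?_ hδ2
  have e5 : δ ^ 2 * (4 / δ ^ 2 * A ^ 2 + 4 / δ ^ 2 * D ^ 2 + 4 / δ ^ 2 * E ^ 2 + 8 * Δ)
      = 4 * (A ^ 2 + D ^ 2 + E ^ 2 + δ ^ 2 * (2 * Δ)) := by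
    field_simp
    ring
  rw [e5]
  have := mul_le_mul_of_nonneg_left hΔs hδ2.le
  rw [mul_pow] at hs hs2
  linarith

/-- The derivative of a random convex function concentrates on average as soon as the function
itself does. -/
theorem integral_variance_deriv_le {Ω : Type*} [MeasurableSpace Ω] (P : Measure Ω)
    [IsProbabilityMeasure P] (F m : Ω → ℝ → ℝ) (hF : ∀ ω r, HasDerivAt (F ω) (m ω r) r)
    (hm : ∀ ω, Monotone (m ω)) (hm1 : ∀ ω r, |m ω r| ≤ 1)
    (hmc : ∀ ω, Continuous (m ω)) (hmm : ∀ r, AEStronglyMeasurable (fun ω => m ω r) P)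
    (hFi : ∀ r, Integrable (fun ω => F ω r) P) (V : ℝ)
    (hFv : ∀ r, Integrable (fun ω => (F ω r - ∫ ω', F ω' r ∂P) ^ 2) P)
    (hV : ∀ r, ∫ ω, (F ω r - ∫ ω', F ω' r ∂P) ^ 2 ∂P ≤ V)
    {a b δ : ℝ} (hab : a ≤ b) (hδ : 0 < δ) (R R' : ℝ → ℝ) (hR : ∀ ε, HasDerivAt R (R' ε) ε)
    (hR'c : Continuous R') (hR' : ∀ ε ∈ Set.Icc a b, 1 ≤ R' ε) :
    ∫ ε in a..b, ∫ ω, (m ω (R ε) - ∫ ω', m ω' (R ε) ∂P) ^ 2 ∂P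
      ≤ (b - a) * (12 * V / δ ^ 2) + 32 * δ := by
  have hmi : ∀ r, Integrable (fun ω => m ω r) P := fun r =>
    Integrable.of_bound (hmm r) 1 (Filter.Eventually.of_forall fun ω => hm1 ω r)
  set Fb : ℝ → ℝ := fun r => ∫ ω, F ω r ∂P with hFb
  set mb : ℝ → ℝ := fun r => ∫ ω, m ω r ∂P with hmb
  have hFbd : ∀ r, HasDerivAt Fb (mb r) r := fun r =>
    (hasDerivAt_integral_of_dominated_loc_of_deriv_le (bound := fun _ => 1)
      (F := fun r ω => F ω r) (F' := fun r ω => m ω r) (s := Set.univ) Filter.univ_mem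
      (Filter.Eventually.of_forall fun r => (hFi r).aestronglyMeasurable) (hFi r) (hmm r)
      (Filter.Eventually.of_forall fun ω r _ => hm1 ω r) (integrable_const _)
      (Filter.Eventually.of_forall fun ω r _ => hF ω r)).2
  have hmbm : Monotone mb := fun x y hxy =>
    integral_mono (hmi x) (hmi y) fun ω => hm ω hxy
  have hmb1 : ∀ r, |mb r| ≤ 1 := fun r => by
    have := norm_integral_le_of_norm_le_const (μ := P) (C := 1)
        (f := fun ω => m ω r) (Filter.Eventually.of_forall fun ω => hm1 ω r)
    simpa using this
  have hmbc : Continuous mb :=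
    continuous_of_dominated (F := fun r ω => m ω r) (bound := fun _ => 1) hmm
      (fun r => Filter.Eventually.of_forall fun ω => hm1 ω r) (integrable_const _)
      (Filter.Eventually.of_forall hmc)
  have hRc : Continuous R := continuous_iff_continuousAt.2 fun ε => (hR ε).continuousAt
  have hpt : ∀ ω r, (m ω r - mb r) ^ 2 ≤ 4 / δ ^ 2 * (F ω (r + δ) - Fb (r + δ)) ^ 2
      + 4 / δ ^ 2 * (F ω r - Fb r) ^ 2 + 4 / δ ^ 2 * (F ω (r - δ) - Fb (r - δ)) ^ 2
      + 8 * (mb (r + δ) - mb (r - δ)) := by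
    intro ω r
    have h1 := (sub_mem_Icc_of_hasDerivAt_of_monotone (hF ω) (hm ω) (lt_add_of_pos_right r hδ)).1
    have h2 := (sub_mem_Icc_of_hasDerivAt_of_monotone (hF ω) (hm ω) (sub_lt_self r hδ)).2
    have h3 := (sub_mem_Icc_of_hasDerivAt_of_monotone hFbd hmbm (lt_add_of_pos_right r hδ)).2
    have h4 := (sub_mem_Icc_of_hasDerivAt_of_monotone hFbd hmbm (sub_lt_self r hδ)).1
    have h5 := hmbm (lt_add_of_pos_right r hδ).le
    have h6 := hmbm (sub_lt_self r hδ).le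
    have h7 := (abs_le.1 (hmb1 (r + δ))).2
    have h8 := (abs_le.1 (hmb1 (r - δ))).1
    have e1 := le_abs_self (F ω (r + δ) - Fb (r + δ))
    have e2 := neg_abs_le (F ω r - Fb r)
    have e3 := le_abs_self (F ω (r - δ) - Fb (r - δ))
    have e4 := abs_nonneg (F ω (r + δ) - Fb (r + δ))
    have e5 := abs_nonneg (F ω (r - δ) - Fb (r - δ))
    have e6 := mul_le_mul_of_nonneg_right h5 hδ.le
    have e7 := mul_le_mul_of_nonneg_right h6 hδ.le
    refine sq_le_of_abs_le_add hδ (by linarith) (by linarith) (abs_le.2 ⟨?_, ?_⟩)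
    · linarith
    · linarith
  have hexp : ∀ r, ∫ ω, (m ω r - mb r) ^ 2 ∂P
      ≤ 12 * V / δ ^ 2 + 8 * (mb (r + δ) - mb (r - δ)) := by
    intro r
    have i1 : ∀ r, Integrable (fun ω => 4 / δ ^ 2 * (F ω r - Fb r) ^ 2) P := fun r =>
      (hFv r).const_mul (4 / δ ^ 2)
    have i12 : Integrable (fun ω => 4 / δ ^ 2 * (F ω (r + δ) - Fb (r + δ)) ^ 2
      + 4 / δ ^ 2 * (F ω r - Fb r) ^ 2) P := (i1 (r + δ)).add (i1 r)
    have i123 : Integrable (fun ω => 4 / δ ^ 2 * (F ω (r + δ) - Fb (r + δ)) ^ 2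
      + 4 / δ ^ 2 * (F ω r - Fb r) ^ 2 + 4 / δ ^ 2 * (F ω (r - δ) - Fb (r - δ)) ^ 2) P :=
      i12.add (i1 (r - δ))
    have ic : Integrable (fun _ : Ω => 8 * (mb (r + δ) - mb (r - δ))) P := integrable_const _
    have iall : Integrable (fun ω => 4 / δ ^ 2 * (F ω (r + δ) - Fb (r + δ)) ^ 2
      + 4 / δ ^ 2 * (F ω r - Fb r) ^ 2 + 4 / δ ^ 2 * (F ω (r - δ) - Fb (r - δ)) ^ 2
      + 8 * (mb (r + δ) - mb (r - δ))) P := i123.add ic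
    refine (integral_mono_of_nonneg (Filter.Eventually.of_forall fun ω => sq_nonneg _) iall
      (Filter.Eventually.of_forall fun ω => hpt ω r)).trans ?_
    have e : ∫ ω, (4 / δ ^ 2 * (F ω (r + δ) - Fb (r + δ)) ^ 2
      + 4 / δ ^ 2 * (F ω r - Fb r) ^ 2 + 4 / δ ^ 2 * (F ω (r - δ) - Fb (r - δ)) ^ 2
      + 8 * (mb (r + δ) - mb (r - δ))) ∂P
        = 4 / δ ^ 2 * ∫ ω, (F ω (r + δ) - Fb (r + δ)) ^ 2 ∂P
      + 4 / δ ^ 2 * ∫ ω, (F ω r - Fb r) ^ 2 ∂P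
      + 4 / δ ^ 2 * ∫ ω, (F ω (r - δ) - Fb (r - δ)) ^ 2 ∂P
      + 8 * (mb (r + δ) - mb (r - δ)) := by
      rw [integral_add i123 ic, integral_add i12 (i1 (r - δ)),
        integral_add (i1 (r + δ)) (i1 r), integral_const_mul, integral_const_mul, integral_const_mul]
      simp
    refine (le_of_eq e).trans ?_
    have hk : 0 ≤ 4 / δ ^ 2 := by positivity
    have j1 := mul_le_mul_of_nonneg_left (hV (r + δ)) hk
    have j2 := mul_le_mul_of_nonneg_left (hV r) hk
    have j3 := mul_le_mul_of_nonneg_left (hV (r - δ)) hk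
    have j4 : 12 * V / δ ^ 2 = 3 * (4 / δ ^ 2 * V) := by ring
    linarith
  have hΔnn : ∀ r, 0 ≤ mb (r + δ) - mb (r - δ) := fun r =>
    sub_nonneg.2 (hmbm (by linarith))
  have hcont : Continuous fun ε => (mb (R ε + δ) - mb (R ε - δ)) * R' ε := by fun_prop
  have hFTC : ∫ ε in a..b, (mb (R ε + δ) - mb (R ε - δ)) * R' ε
      = (Fb (R b + δ) - Fb (R b - δ)) - (Fb (R a + δ) - Fb (R a - δ)) := by
    refine intervalIntegral.integral_eq_sub_of_hasDerivAt
      (f := fun ε => Fb (R ε + δ) - Fb (R ε - δ)) (fun ε _ => ?_) (hcont.intervalIntegrable _ _)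
    have h1 := (hFbd (R ε + δ)).comp ε ((hR ε).add_const δ)
    have h2 := (hFbd (R ε - δ)).comp ε ((hR ε).sub_const δ)
    rw [sub_mul]
    exact h1.sub h2
  have hlip : ∀ r, |Fb (r + δ) - Fb (r - δ)| ≤ 2 * δ := by
    intro r
    obtain ⟨h1, h2⟩ := sub_mem_Icc_of_hasDerivAt_of_monotone hFbd hmbm
      (show r - δ < r + δ by linarith)
    have h7 := (abs_le.1 (hmb1 (r + δ))).2
    have h8 := (abs_le.1 (hmb1 (r - δ))).1
    rw [abs_le]
    constructor <;> nlinarith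
  have hg : Continuous fun ε => 12 * V / δ ^ 2 + 8 * ((mb (R ε + δ) - mb (R ε - δ)) * R' ε) := by
    fun_prop
  calc ∫ ε in a..b, ∫ ω, (m ω (R ε) - mb (R ε)) ^ 2 ∂P
      ≤ ∫ ε in a..b, (12 * V / δ ^ 2 + 8 * ((mb (R ε + δ) - mb (R ε - δ)) * R' ε)) := by
        rw [intervalIntegral.integral_of_le hab, intervalIntegral.integral_of_le hab]
        refine integral_mono_of_nonneg
          (Filter.Eventually.of_forall fun ε => integral_nonneg fun ω => sq_nonneg _)
          ((hg.intervalIntegrable a b).1) ?_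
        filter_upwards [ae_restrict_mem measurableSet_Ioc] with ε hε
        have h1 := le_mul_of_one_le_right (hΔnn (R ε)) (hR' ε ⟨hε.1.le, hε.2⟩)
        linarith [hexp (R ε)]
    _ = (b - a) * (12 * V / δ ^ 2) + 8 * ((Fb (R b + δ) - Fb (R b - δ))
          - (Fb (R a + δ) - Fb (R a - δ))) := by
        rw [intervalIntegral.integral_add (by simp)
          ((hcont.const_mul 8).intervalIntegrable _ _), intervalIntegral.integral_const_mul,
          hFTC, intervalIntegral.integral_const, smul_eq_mul]
    _ ≤ (b - a) * (12 * V / δ ^ 2) + 32 * δ := by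
        have h1 := (abs_le.1 (hlip (R b))).2
        have h2 := (abs_le.1 (hlip (R a))).1
        linarith

/-- The partition function of the interpolating model. -/
noncomputable def partitionRCW (J β : ℝ) (n : ℕ) (t R : ℝ) (hs : Fin n → ℝ) : ℝ :=
  ∑ σ : Fin n → Bool, Real.exp (-(β * Hrcw J n t R hs σ))

theorem abs_mag_le_one {n : ℕ} (hn : 1 ≤ n) (σ : Fin n → Bool) : |mag n σ| ≤ 1 := by
  have hn' : (0 : ℝ) < n := by exact_mod_cast hn
  rw [mag, abs_div, abs_of_pos hn', div_le_one hn', magSum]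
  refine (Finset.abs_sum_le_sum_abs _ _).trans ?_
  simp [abs_spin]

theorem partitionRCW_pos (J β : ℝ) (n : ℕ) (t R : ℝ) (hs : Fin n → ℝ) :
    0 < partitionRCW J β n t R hs :=
  Finset.sum_pos (fun _ _ => Real.exp_pos _) Finset.univ_nonempty

theorem continuous_partitionRCW (J β : ℝ) (n : ℕ) (t : ℝ) :
    Continuous fun p : ℝ × (Fin n → ℝ) => partitionRCW J β n t p.1 p.2 := by
  unfold partitionRCW Hrcw
  fun_prop

theorem continuous_gibbsRCW (J β : ℝ) (n : ℕ) (t : ℝ) (A : (Fin n → Bool) → ℝ) :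
    Continuous fun p : ℝ × (Fin n → ℝ) => gibbsRCW J β n t p.1 p.2 A := by
  refine Continuous.div ?_ (continuous_partitionRCW J β n t)
    (fun p => (partitionRCW_pos J β n t p.1 p.2).ne')
  unfold Hrcw
  fun_prop

theorem abs_gibbsRCW_mag_le_one (J β : ℝ) {n : ℕ} (hn : 1 ≤ n) (t R : ℝ) (hs : Fin n → ℝ) :
    |gibbsRCW J β n t R hs (mag n)| ≤ 1 := by
  have hZ := partitionRCW_pos J β n t R hs
  unfold gibbsRCW
  unfold partitionRCW at hZ
  rw [abs_div, abs_of_pos hZ, div_le_one hZ]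
  refine (Finset.abs_sum_le_sum_abs _ _).trans (Finset.sum_le_sum fun σ _ => ?_)
  rw [abs_mul, Real.abs_exp]
  exact mul_le_of_le_one_left (Real.exp_pos _).le (abs_mag_le_one hn σ)

theorem Hrcw_add (J : ℝ) {n : ℕ} (hn : 1 ≤ n) (t R d : ℝ) (hs : Fin n → ℝ)
    (σ : Fin n → Bool) : Hrcw J n t (R + d) hs σ = Hrcw J n t R hs σ - J * n * d * mag n σ := by
  have hn' : (n : ℝ) ≠ 0 := by exact_mod_cast (by omega : n ≠ 0)
  unfold Hrcw mag
  field_simp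
  ring

theorem monotone_gibbsRCW_mag {J β : ℝ} (hJ : 0 < J) (hβ : 0 < β) {n : ℕ} (hn : 1 ≤ n) (t : ℝ)
    (hs : Fin n → ℝ) : Monotone fun R => gibbsRCW J β n t R hs (mag n) := by
  intro r r' hr
  obtain ⟨d, hd, rfl⟩ : ∃ d, 0 ≤ d ∧ r' = r + d := ⟨r' - r, sub_nonneg.2 hr, by ring⟩
  have hZ := partitionRCW_pos J β n t r hs
  have hZ' := partitionRCW_pos J β n t (r + d) hs
  unfold partitionRCW at hZ hZ'
  change gibbsRCW J β n t r hs (mag n) ≤ gibbsRCW J β n t (r + d) hs (mag n)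
  unfold gibbsRCW
  rw [div_le_div_iff₀ hZ hZ']
  set w : (Fin n → Bool) → ℝ := fun σ => Real.exp (-(β * Hrcw J n t r hs σ)) with hw
  set k := β * (J * n * d)
  have hk : 0 ≤ k := by positivity
  have hw' : ∀ σ, Real.exp (-(β * Hrcw J n t (r + d) hs σ)) = w σ * Real.exp (k * mag n σ) := by
    intro σ
    rw [hw, ← Real.exp_add, Hrcw_add J hn]
    congr 1
    ring
  simp_rw [hw']
  have hpair : ∀ σ τ, 0 ≤ w σ * w τ * ((mag n σ - mag n τ)
      * (Real.exp (k * mag n σ) - Real.exp (k * mag n τ))) := by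
    intro σ τ
    refine mul_nonneg (mul_nonneg (Real.exp_pos _).le (Real.exp_pos _).le) ?_
    rcases le_total (mag n σ) (mag n τ) with h | h
    · exact mul_nonneg_of_nonpos_of_nonpos (sub_nonpos.2 h)
        (sub_nonpos.2 (Real.exp_le_exp.2 (mul_le_mul_of_nonneg_left h hk)))
    · exact mul_nonneg (sub_nonneg.2 h)
        (sub_nonneg.2 (Real.exp_le_exp.2 (mul_le_mul_of_nonneg_left h hk)))
  have hsum := Finset.sum_nonneg fun σ (_ : σ ∈ Finset.univ) =>
    Finset.sum_nonneg fun τ (_ : τ ∈ Finset.univ) => hpair σ τ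
  set Z := ∑ σ, w σ with hZdef
  set A := ∑ σ, mag n σ * w σ with hA
  set B := ∑ σ, w σ * Real.exp (k * mag n σ) with hB
  set D := ∑ σ, mag n σ * (w σ * Real.exp (k * mag n σ)) with hD
  have key : ∑ σ, ∑ τ, w σ * w τ * ((mag n σ - mag n τ)
      * (Real.exp (k * mag n σ) - Real.exp (k * mag n τ))) = D * Z - A * B - B * A + Z * D := by
    rw [hD, hA, hB, hZdef]
    simp_rw [Finset.sum_mul_sum, ← Finset.sum_sub_distrib, ← Finset.sum_add_distrib]
    exact Finset.sum_congr rfl fun σ _ => Finset.sum_congr rfl fun τ _ => by ring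
  rw [key] at hsum
  linarith

/-- The normalized log-partition function, whose derivative in the effective field is the
magnetization. -/
noncomputable def logPartitionRCW (J β : ℝ) (n : ℕ) (t : ℝ) (hs : Fin n → ℝ) (R : ℝ) : ℝ :=
  Real.log (partitionRCW J β n t R hs) / (β * J * n)

theorem hasDerivAt_logPartitionRCW {J β : ℝ} (hJ : 0 < J) (hβ : 0 < β) {n : ℕ} (hn : 1 ≤ n)
    (t : ℝ) (hs : Fin n → ℝ) (R : ℝ) :
    HasDerivAt (logPartitionRCW J β n t hs) (gibbsRCW J β n t R hs (mag n)) R := by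
  have hn' : (0 : ℝ) < n := by exact_mod_cast hn
  have hH : ∀ σ, HasDerivAt (fun R => Hrcw J n t R hs σ) (-(J * magSum n σ)) R := by
    intro σ
    unfold Hrcw
    have h := ((((hasDerivAt_id R).const_mul J).mul_const (magSum n σ)).const_sub
      ((1 - t) * (-(J / n) * pairSum n σ))).sub_const (∑ i : Fin n, hs i * spin (σ i))
    simpa using h
  have hZ : HasDerivAt (fun R => partitionRCW J β n t R hs)
      (∑ σ, Real.exp (-(β * Hrcw J n t R hs σ)) * -(β * -(J * magSum n σ))) R :=
    HasDerivAt.fun_sum fun σ _ => ((hH σ).const_mul β).fun_neg.exp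
  have h := (hZ.log (partitionRCW_pos J β n t R hs).ne').div_const (β * J * n)
  refine h.congr_deriv ?_
  have hp := partitionRCW_pos J β n t R hs
  symm
  change (∑ σ, mag n σ * Real.exp (-(β * Hrcw J n t R hs σ))) / partitionRCW J β n t R hs = _
  rw [div_right_comm]
  congr 1
  rw [Finset.sum_div]
  refine Finset.sum_congr rfl fun σ _ => ?_
  unfold mag
  field_simp

theorem abs_logPartitionRCW_sub_le {J β : ℝ} (hJ : 0 < J) (hβ : 0 < β) {n : ℕ} (hn : 1 ≤ n)
    (t R : ℝ) (hs hs' : Fin n → ℝ) :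
    |logPartitionRCW J β n t hs R - logPartitionRCW J β n t hs' R|
      ≤ (∑ i, |hs i - hs' i|) / (J * n) := by
  have hn' : (0 : ℝ) < n := by exact_mod_cast hn
  have key : ∀ g g' : Fin n → ℝ, Real.log (partitionRCW J β n t R g)
      ≤ Real.log (partitionRCW J β n t R g') + β * ∑ i, |g i - g' i| := by
    intro g g'
    have hp := partitionRCW_pos J β n t R g'
    rw [← Real.log_exp (β * ∑ i, |g i - g' i|), ← Real.log_mul hp.ne' (Real.exp_pos _).ne']
    refine Real.log_le_log (partitionRCW_pos J β n t R g) ?_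
    unfold partitionRCW
    rw [Finset.sum_mul]
    refine Finset.sum_le_sum fun σ _ => ?_
    rw [← Real.exp_add, Real.exp_le_exp]
    have h1 : ∑ i, g i * spin (σ i) - ∑ i, g' i * spin (σ i) ≤ ∑ i, |g i - g' i| := by
      rw [← Finset.sum_sub_distrib]
      refine Finset.sum_le_sum fun i _ => ?_
      rw [← sub_mul]
      refine (le_abs_self _).trans ?_
      rw [abs_mul, abs_spin, mul_one]
    have h2 := mul_le_mul_of_nonneg_left h1 hβ.le
    unfold Hrcw
    linarith
  have h1 := key hs hs'
  have h2 := key hs' hs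
  simp_rw [abs_sub_comm (hs' _) (hs _)] at h2
  unfold logPartitionRCW
  rw [← sub_div, abs_div, abs_of_pos (show 0 < β * J * n by positivity),
    div_le_div_iff₀ (by positivity) (by positivity)]
  have h3 : |Real.log (partitionRCW J β n t R hs) - Real.log (partitionRCW J β n t R hs')|
      ≤ β * ∑ i, |hs i - hs' i| := abs_le.2 ⟨by linarith, by linarith⟩
  calc _ ≤ (β * ∑ i, |hs i - hs' i|) * (J * n) :=
        mul_le_mul_of_nonneg_right h3 (by positivity)
    _ = _ := by ring

theorem continuous_logPartitionRCW (J β : ℝ) (n : ℕ) (t R : ℝ) :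
    Continuous fun hs => logPartitionRCW J β n t hs R :=
  (Continuous.log ((continuous_partitionRCW J β n t).comp (Continuous.prodMk_right R))
    fun hs => (partitionRCW_pos J β n t R hs).ne').div_const _

theorem ae_pi_of_forall_mem_Icc {μ : Measure ℝ} [IsProbabilityMeasure μ] {S : ℝ}
    (hμ : ∀ᵐ x ∂μ, x ∈ Set.Icc (-S) S) (n : ℕ) :
    ∀ᵐ x ∂(Measure.pi fun _ : Fin n => μ), ∀ i, x i ∈ Set.Icc (-S) S :=
  Filter.eventually_all.2 fun _ => Measure.tendsto_eval_ae_ae.eventually hμ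

theorem integrable_pi_of_continuous_of_ae_mem_Icc {μ : Measure ℝ} [IsProbabilityMeasure μ] {S : ℝ}
    (hμ : ∀ᵐ x ∂μ, x ∈ Set.Icc (-S) S) {n : ℕ} {f : (Fin n → ℝ) → ℝ} (hf : Continuous f) :
    Integrable f (Measure.pi fun _ : Fin n => μ) := by
  obtain ⟨B, hB⟩ := (isCompact_univ_pi fun _ : Fin n => isCompact_Icc (a := -S) (b := S)
    ).exists_bound_of_continuousOn hf.continuousOn
  refine Integrable.of_bound hf.aestronglyMeasurable B ?_
  filter_upwards [ae_pi_of_forall_mem_Icc hμ n] with x hx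
  exact hB x fun i _ => hx i

theorem variance_logPartitionRCW_le {J β S : ℝ} (hJ : 0 < J) (hβ : 0 < β) (hS : 0 < S)
    {μ : Measure ℝ} [IsProbabilityMeasure μ] (hμ : ∀ᵐ x ∂μ, x ∈ Set.Icc (-S) S)
    {n : ℕ} (hn : 1 ≤ n) (t R : ℝ) :
    ∫ hs, (logPartitionRCW J β n t hs R
        - ∫ hs', logPartitionRCW J β n t hs' R ∂(Measure.pi fun _ : Fin n => μ)) ^ 2
        ∂(Measure.pi fun _ : Fin n => μ) ≤ 4 * S ^ 2 / J ^ 2 / n := by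
  have hn' : (0 : ℝ) < n := by exact_mod_cast hn
  set P := Measure.pi fun _ : Fin n => μ
  set f : (Fin n → ℝ) → ℝ := fun hs => logPartitionRCW J β n t hs R
  have hfc : Continuous f := continuous_logPartitionRCW J β n t R
  let cl : ℝ → ℝ := fun x => max (-S) (min S x)
  have hcl : ∀ x, cl x ∈ Set.Icc (-S) S := fun x =>
    ⟨le_max_left _ _, max_le (by linarith) (min_le_left _ _)⟩
  let g : (Fin n → ℝ) → ℝ := fun hs => f fun i => cl (hs i)
  have hgc : Continuous g := by fun_prop
  have hfg : f =ᵐ[P] g := by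
    filter_upwards [ae_pi_of_forall_mem_Icc hμ n] with x hx
    refine congrArg f (funext fun i => ?_)
    have := hx i
    simp [cl, min_eq_right this.2, max_eq_right this.1]
  obtain ⟨B, hB⟩ := (isCompact_univ_pi fun _ : Fin n => isCompact_Icc (a := -S) (b := S)
    ).exists_bound_of_continuousOn hfc.continuousOn
  have hI : ∫ y, f y ∂P = ∫ y, g y ∂P := integral_congr_ae hfg
  have hV : ∫ x, (f x - ∫ y, f y ∂P) ^ 2 ∂P = ∫ x, (g x - ∫ y, g y ∂P) ^ 2 ∂P := by
    rw [hI]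
    refine integral_congr_ae ?_
    filter_upwards [hfg] with x hx
    rw [hx]
  have hgB : ∀ x, |g x| ≤ B := fun x => hB (fun i => cl (x i)) fun i _ => hcl (x i)
  have hgd : ∀ x y i, (∀ j, j ≠ i → x j = y j) → |g x - g y| ≤ 2 * S / (J * n) := by
    intro x y i hxy
    have h := abs_logPartitionRCW_sub_le hJ hβ hn t R (fun i => cl (x i)) (fun i => cl (y i))
    have hsum : ∑ j, |cl (x j) - cl (y j)| = |cl (x i) - cl (y i)| :=
      Finset.sum_eq_single i (fun j _ hj => by rw [hxy j hj, sub_self, abs_zero])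
        (fun hi => absurd (Finset.mem_univ i) hi)
    rw [hsum] at h
    have h1 := hcl (x i)
    have h2 := hcl (y i)
    exact h.trans (div_le_div_of_nonneg_right
      (abs_le.2 ⟨by linarith [h1.1, h2.2], by linarith [h1.2, h2.1]⟩) (by positivity))
  rw [hV]
  refine (integral_sub_integral_sq_le_of_bounded_differences μ (2 * S / (J * n)) B n g
    hgc.measurable hgB hgd).trans (le_of_eq ?_)
  field_simp
  ring

/-- Quenched concentration of the magnetization for the random-field Curie-Weiss
interpolating model: there exists a constant `C(S,J) > 0` depending only on `S` and
`J` such that, whenever `ε ↦ R_ε(t)` is regular,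
`∫_{s_n}^{2s_n} dε E[(⟨M⟩_{t,ε} - E⟨M⟩_{t,ε})²] ≤ C(S,J)·(s_n/n)^{1/3}`. -/
theorem curieWeiss_randomField_quenched_concentration (J S : ℝ) (hJ : 0 < J) (hS : 0 < S) :
    ∃ C > 0, ∀ (β : ℝ), 0 < β →
      ∀ (Ph : Measure ℝ), IsProbabilityMeasure Ph →
      (∀ᵐ x ∂Ph, x ∈ Set.Icc (-S) S) →
      ∀ (n : ℕ), 1 ≤ n → ∀ t ∈ Set.Icc (0 : ℝ) 1, ∀ sn ∈ Set.Ioc (0 : ℝ) (1 / 2),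
      ∀ (R R' : ℝ → ℝ), (∀ ε, HasDerivAt R (R' ε) ε) → Continuous R' →
      (∀ ε ∈ Set.Icc sn (2 * sn), 1 ≤ R' ε) →
      ∫ ε in sn..(2 * sn),
          ∫ hs : Fin n → ℝ,
            (gibbsRCW J β n t (R ε) hs (mag n)
              - ∫ hs' : Fin n → ℝ, gibbsRCW J β n t (R ε) hs' (mag n)
                  ∂(Measure.pi fun _ : Fin n => Ph)) ^ 2
          ∂(Measure.pi fun _ : Fin n => Ph)
        ≤ C * (sn / n) ^ ((1 : ℝ) / 3) := by
  refine ⟨48 * S ^ 2 / J ^ 2 + 32, by positivity, ?_⟩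
  intro β hβ Ph hPh hsupp n hn t _ sn hsn R R' hR hR'c hR'
  have hn' : (0 : ℝ) < n := by exact_mod_cast hn
  have hsn0 : 0 < sn := hsn.1
  have hq : 0 < sn / n := by positivity
  set δ := (sn / n) ^ ((1 : ℝ) / 3) with hδdef
  have hδ : 0 < δ := Real.rpow_pos_of_pos hq _
  have hδ3 : δ ^ 3 = sn / n := by
    rw [hδdef, ← Real.rpow_natCast, ← Real.rpow_mul hq.le]
    norm_num
  have hgc := continuous_gibbsRCW J β n t (mag n)
  have hfields : ∀ r, Continuous fun hs => gibbsRCW J β n t r hs (mag n) := fun r => by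
    have h := hgc.comp (Continuous.prodMk_right r)
    exact h
  have heff : ∀ hs, Continuous fun r => gibbsRCW J β n t r hs (mag n) := fun hs => by
    have h := hgc.comp (Continuous.prodMk_left hs)
    exact h
  have hmain := integral_variance_deriv_le (Measure.pi fun _ : Fin n => Ph)
    (logPartitionRCW J β n t) (fun hs r => gibbsRCW J β n t r hs (mag n))
    (fun hs r => hasDerivAt_logPartitionRCW hJ hβ hn t hs r)
    (fun hs => monotone_gibbsRCW_mag hJ hβ hn t hs)
    (fun hs r => abs_gibbsRCW_mag_le_one J β hn t r hs)
    heff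
    (fun r => (hfields r).aestronglyMeasurable)
    (fun r => integrable_pi_of_continuous_of_ae_mem_Icc hsupp
      (continuous_logPartitionRCW J β n t r))
    (4 * S ^ 2 / J ^ 2 / n)
    (fun r => integrable_pi_of_continuous_of_ae_mem_Icc hsupp
      (((continuous_logPartitionRCW J β n t r).sub continuous_const).pow 2))
    (fun r => variance_logPartitionRCW_le hJ hβ hS hsupp hn t r)
    (show sn ≤ 2 * sn by linarith) hδ R R' hR hR'c hR'
  refine hmain.trans (le_of_eq ?_)
  have h1 : (2 * sn - sn) * (12 * (4 * S ^ 2 / J ^ 2 / n) / δ ^ 2)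
      = 48 * S ^ 2 / J ^ 2 * ((sn / n) / δ ^ 2) := by
    field_simp
    ring
  rw [h1, ← hδ3]
  field_simp
end
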